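/- arXiv:1811.03112 — 2 statements merged into one kernel-verified Lean document; each statement's English description precedes it below -/
import Mathlib

section
/- If I ⊆ M_n is a decreasing set of monomials, then the complementary set M_n \ Ī, where Ī = {ᾱ : α ∈ I}, is also a decreasing set. -/
/-- Same-degree comparison of monomials via their sorted supports. -/
def sameDegLE {n : ℕ} (S T : Finset (Fin n)) : Prop :=
  List.Forall₂ (· ≤ ·) (S.sort (· ≤ ·)) (T.sort (· ≤ ·))

/-- The strong order on monomials (identified with their supports). -/
def strongLE {n : ℕ} (S T : Finset (Fin n)) : Prop :=
  (S.card = T.card ∧ sameDegLE S T) ∨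
  (S.card < T.card ∧ ∃ T' : Finset (Fin n), T'.card = S.card ∧ sameDegLE S T' ∧ T' ⊆ T)

/-- A set of monomials `I` is decreasing iff `g ∈ I` and `f ≼ g` imply `f ∈ I`. -/
def Decreasing {n : ℕ} (I : Set (Finset (Fin n))) : Prop :=
  ∀ ⦃f g : Finset (Fin n)⦄, g ∈ I → strongLE f g → f ∈ I

theorem countP_le_of_forall₂_le {α : Type*} [LinearOrder α] {l₁ l₂ : List α}
    (h : List.Forall₂ (· ≤ ·) l₁ l₂) (a : α) :
    l₁.countP (a ≤ ·) ≤ l₂.countP (a ≤ ·) := by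
  induction h with
  | nil => simp
  | @cons x y l₁ l₂ hxy _ ih =>
    simp only [List.countP_cons, decide_eq_true_eq]
    have hle : a ≤ x → a ≤ y := fun hx => hx.trans hxy
    split_ifs <;> first | omega | tauto

theorem forall₂_le_of_countP_le {α : Type*} [LinearOrder α] {l₁ l₂ : List α}
    (h₁ : l₁.Pairwise (· ≤ ·)) (h₂ : l₂.Pairwise (· ≤ ·)) (hlen : l₁.length = l₂.length)
    (h : ∀ a, l₁.countP (a ≤ ·) ≤ l₂.countP (a ≤ ·)) :
    List.Forall₂ (· ≤ ·) l₁ l₂ := by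
  induction l₁ generalizing l₂ with
  | nil =>
    obtain rfl : l₂ = [] := List.eq_nil_of_length_eq_zero hlen.symm
    exact .nil
  | cons x xs ih =>
    obtain _ | ⟨y, ys⟩ := l₂
    · simp at hlen
    rw [List.pairwise_cons] at h₁ h₂
    have hlen' : xs.length = ys.length := by simpa using hlen
    have count_tail : ∀ a ≤ y, ys.countP (a ≤ ·) = ys.length := fun a ha =>
      List.countP_eq_length.2 fun z hz => by simpa using ha.trans (h₂.1 z hz)
    have hxs : xs.countP (x ≤ ·) = xs.length :=
      List.countP_eq_length.2 fun z hz => by simpa using h₁.1 z hz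
    have hxy : x ≤ y := by
      by_contra hxy
      have hx := h x
      simp only [List.countP_cons, decide_eq_true_eq, le_refl, if_true, hxy, if_false] at hx
      have := List.countP_le_length (p := fun z => decide (x ≤ z)) (l := ys)
      omega
    refine .cons hxy (ih h₁.2 h₂.2 hlen' fun a => ?_)
    have hxs_le := List.countP_le_length (p := fun z => decide (a ≤ z)) (l := xs)
    by_cases ha : a ≤ y
    · rw [count_tail a ha]
      omega
    · have hax := h a
      simp only [List.countP_cons, decide_eq_true_eq, ha, if_false] at hax
      omega

theorem countP_sort {α : Type*} [LinearOrder α] (S : Finset α) (p : α → Prop)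
    [DecidablePred p] : (S.sort (· ≤ ·)).countP (fun x => p x) = (S.filter p).card := by
  rw [← Multiset.coe_countP, Finset.sort_eq, Multiset.countP_eq_card_filter]
  rfl

theorem sameDegLE.card_eq {n : ℕ} {S T : Finset (Fin n)} (h : sameDegLE S T) :
    S.card = T.card := by
  simpa using List.Forall₂.length_eq h

theorem sameDegLE_iff {n : ℕ} {S T : Finset (Fin n)} (hcard : S.card = T.card) :
    sameDegLE S T ↔ ∀ a, (S.filter (a ≤ ·)).card ≤ (T.filter (a ≤ ·)).card := by
  simp only [← countP_sort]
  exact ⟨countP_le_of_forall₂_le, forall₂_le_of_countP_le (Finset.pairwise_sort S (· ≤ ·))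
    (Finset.pairwise_sort T (· ≤ ·)) (by simpa using hcard)⟩

theorem sameDegLE.refl {n : ℕ} (S : Finset (Fin n)) : sameDegLE S S :=
  (sameDegLE_iff rfl).2 fun _ => le_rfl

theorem card_filter_add_card_filter_compl {α : Type*} [Fintype α] [DecidableEq α]
    (S : Finset α) (p : α → Prop) [DecidablePred p] :
    (S.filter p).card + (Sᶜ.filter p).card = (Finset.univ.filter p).card := by
  rw [← Finset.card_union_of_disjoint (Finset.disjoint_filter_filter disjoint_compl_right),
    ← Finset.filter_union, Finset.union_compl]

theorem sameDegLE.compl {n : ℕ} {S T : Finset (Fin n)} (h : sameDegLE S T) :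
    sameDegLE Tᶜ Sᶜ := by
  have hcard := h.card_eq
  refine (sameDegLE_iff (by simp [Finset.card_compl, hcard])).2 fun a => ?_
  have ha := (sameDegLE_iff hcard).1 h a
  have hS := card_filter_add_card_filter_compl S (a ≤ ·)
  have hT := card_filter_add_card_filter_compl T (a ≤ ·)
  omega

theorem strongLE_of_sameDegLE {n : ℕ} {S T : Finset (Fin n)} (h : sameDegLE S T) :
    strongLE S T :=
  .inl ⟨h.card_eq, h⟩

theorem strongLE_of_subset {n : ℕ} {S T : Finset (Fin n)} (h : S ⊆ T) : strongLE S T := by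
  obtain rfl | hlt := h.eq_or_ssubset
  · exact strongLE_of_sameDegLE (.refl S)
  · exact .inr ⟨Finset.card_lt_card hlt, S, rfl, .refl S, h⟩

/-- if `I ⊆ M_n` is a decreasing set of monomials, then the
complementary set `M_n \ Ī`, where `Ī = {ᾱ : α ∈ I}`, is also decreasing. -/
theorem decreasing_compl_of_decreasing (n : ℕ) (I : Set (Finset (Fin n)))
    (hI : Decreasing I) :
    Decreasing (((fun S : Finset (Fin n) => Sᶜ) '' I)ᶜ) := by
  rintro f g hg hfg ⟨S, hS, rfl⟩
  refine hg ⟨gᶜ, ?_, compl_compl g⟩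
  obtain ⟨-, h⟩ | ⟨-, T, -, h, hTg⟩ := hfg
  · exact hI hS (strongLE_of_sameDegLE (by simpa using h.compl))
  · have hT : Tᶜ ∈ I := hI hS (strongLE_of_sameDegLE (by simpa using h.compl))
    exact hI hT (strongLE_of_subset (Finset.compl_subset_compl.2 hTg))
end

section
/- Let I ⊆ M_n be a decreasing set of monomials and C(I) the corresponding monomial code. Then the dual code of C(I) with respect to the standard F_2 inner product is the monomial code C(M_n \ Ī), where Ī = {ᾱ : α ∈ I}: that is, C(I)^⊥ = C(M_n \ Ī). -/
/-- The evaluation vector of the monomial with support `S ⊆ {0,…,n−1}`. -/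
def ev {n : ℕ} (S : Finset (Fin n)) : (Fin n → ZMod 2) → ZMod 2 :=
  fun u => ∏ i ∈ S, u i

/-- The monomial code `C(I)`: the `F_2`-span of the evaluation vectors of `I`. -/
def monomialCode {n : ℕ} (I : Set (Finset (Fin n))) :
    Submodule (ZMod 2) ((Fin n → ZMod 2) → ZMod 2) :=
  Submodule.span (ZMod 2) (ev '' I)

theorem ev_mul_ev {n : ℕ} (S T : Finset (Fin n)) (u : Fin n → ZMod 2) :
    ev S u * ev T u = ev (S ∪ T) u := by
  have hsq : ∀ x : ZMod 2, x * x = x := by decide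
  have hinter : ∏ i ∈ S ∪ T, u i = (∏ i ∈ S ∪ T, u i) * ∏ i ∈ S ∩ T, u i := by
    rw [← Finset.prod_sdiff (Finset.inter_subset_union : S ∩ T ⊆ S ∪ T), mul_assoc, hsq]
  rw [ev, ev, ev, hinter, Finset.prod_union_inter]

theorem sum_ev {n : ℕ} (S : Finset (Fin n)) :
    ∑ u : Fin n → ZMod 2, ev S u = if S = Finset.univ then 1 else 0 := by
  have hev : ∀ u : Fin n → ZMod 2, ev S u = ∏ i, if i ∈ S then u i else 1 := by
    intro u
    simp [ev, Finset.prod_ite_mem]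
  have hsum : ∀ i : Fin n, (∑ x : ZMod 2, if i ∈ S then x else 1) = if i ∈ S then 1 else 0 := by
    intro i
    split_ifs <;> decide
  have hprod := Finset.prod_univ_sum (fun _ : Fin n => (Finset.univ : Finset (ZMod 2)))
    (fun i x => if i ∈ S then x else 1)
  rw [Fintype.piFinset_univ] at hprod
  simp_rw [hev]
  rw [← hprod]
  simp_rw [hsum]
  split_ifs with h
  · simp [h]
  · obtain ⟨i, hi⟩ : ∃ i, i ∉ S := by
      by_contra! hall
      exact h (Finset.eq_univ_iff_forall.2 hall)
    exact Finset.prod_eq_zero (Finset.mem_univ i) (if_neg hi)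

/-- Two monomials are orthogonal unless their supports cover all variables. -/
theorem sum_ev_mul_ev {n : ℕ} (S T : Finset (Fin n)) :
    ∑ u : Fin n → ZMod 2, ev S u * ev T u = if Sᶜ ⊆ T then 1 else 0 := by
  simp_rw [ev_mul_ev, sum_ev]
  refine if_congr ?_ rfl rfl
  simp only [Finset.eq_univ_iff_forall, Finset.subset_iff, Finset.mem_union, Finset.mem_compl]
  exact forall_congr' fun i => or_iff_not_imp_left

/-- Every function on `F_2^n` is a combination of monomials. -/
theorem exists_eq_sum_smul_ev {n : ℕ} (v : (Fin n → ZMod 2) → ZMod 2) :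
    ∃ c : Finset (Fin n) → ZMod 2, v = ∑ T, c T • ev T := by
  refine ⟨fun T => ∑ a, v a * ∏ i ∈ Finset.univ \ T, (1 + a i), ?_⟩
  funext u
  have hpt : ∀ x y : ZMod 2, x + (1 + y) = if x = y then 1 else 0 := by decide
  have hind : ∀ a : Fin n → ZMod 2, ∏ i, (u i + (1 + a i)) = if u = a then 1 else 0 := by
    intro a
    simp_rw [hpt, Finset.prod_ite_zero, funext_iff]
    simp
  calc v u = ∑ a, v a * ∏ i, (u i + (1 + a i)) := by simp [hind]
    _ = ∑ a, ∑ T, v a * (ev T u * ∏ i ∈ Finset.univ \ T, (1 + a i)) := by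
      simp_rw [Finset.prod_add, Finset.mul_sum, Finset.powerset_univ, ev]
    _ = _ := by
      rw [Finset.sum_comm]
      simp only [Finset.sum_apply, Pi.smul_apply, smul_eq_mul, Finset.sum_mul]
      exact Finset.sum_congr rfl fun T _ => Finset.sum_congr rfl fun a _ => by ring

/-- for a decreasing set `I ⊆ M_n`, the dual of the monomial code
`C(I)` with respect to the standard `F_2` inner product is `C(M_n \ Ī)`,
where `Ī = {ᾱ : α ∈ I}`. -/
theorem dual_of_decreasing_monomialCode (n : ℕ) (I : Set (Finset (Fin n)))
    (hI : Decreasing I) :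
    {v : (Fin n → ZMod 2) → ZMod 2 |
        ∀ w ∈ monomialCode I, ∑ u : Fin n → ZMod 2, v u * w u = 0}
      = ↑(monomialCode (((fun S : Finset (Fin n) => Sᶜ) '' I)ᶜ)) := by
  have hsub : ∀ {S T : Finset (Fin n)}, T ∈ I → S ⊆ T → S ∈ I := fun hT h =>
    hI hT (strongLE_of_subset h)
  ext v
  simp only [Set.mem_ofPred_eq, SetLike.mem_coe]
  constructor
  · intro hv
    obtain ⟨c, rfl⟩ := exists_eq_sum_smul_ev v
    have horth : ∀ S ∈ I, ∑ T, (if Sᶜ ⊆ T then c T else 0) = 0 := by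
      intro S hS
      refine Eq.trans ?_ (hv (ev S) (Submodule.subset_span ⟨S, hS, rfl⟩))
      simp only [Finset.sum_apply, Pi.smul_apply, smul_eq_mul, Finset.sum_mul]
      rw [Finset.sum_comm]
      refine Finset.sum_congr rfl fun T _ => ?_
      simp_rw [mul_assoc, ← Finset.mul_sum, mul_comm (ev T _), sum_ev_mul_ev, mul_ite, mul_one,
        mul_zero]
    have hc : ∀ S : Finset (Fin n), S ∈ I → c Sᶜ = 0 := by
      intro S
      induction S using Finset.strongInduction with
      | H S ih =>
        intro hS
        rw [← horth S hS, Finset.sum_eq_single Sᶜ, if_pos subset_rfl]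
        · intro T _ hT
          split_ifs with h
          · have hlt : Tᶜ ⊂ S := by
              refine lt_of_le_of_ne (compl_le_iff_compl_le.1 h) ?_
              rintro rfl
              exact hT (compl_compl T).symm
            simpa using ih Tᶜ hlt (hsub hS hlt.subset)
          · rfl
        · simp
    refine Submodule.sum_mem _ fun T _ => ?_
    by_cases hT : Tᶜ ∈ I
    · have h0 : c T = 0 := by simpa using hc Tᶜ hT
      simp [h0]
    · refine Submodule.smul_mem _ _ (Submodule.subset_span ⟨T, ?_, rfl⟩)
      rintro ⟨S, hS, rfl⟩
      exact hT (by simpa using hS)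
  · intro hv w hw
    induction hv using Submodule.span_induction with
    | zero => simp
    | add x y _ _ hx hy => simp [add_mul, Finset.sum_add_distrib, hx, hy]
    | smul a x _ hx => simp [mul_assoc, ← Finset.mul_sum, hx]
    | mem x hx =>
      obtain ⟨T, hT, rfl⟩ := hx
      induction hw using Submodule.span_induction with
      | zero => simp
      | add x y _ _ hx hy => simp [mul_add, Finset.sum_add_distrib, hx, hy]
      | smul a x _ hx => simp [mul_left_comm _ a, ← Finset.mul_sum, hx]
      | mem y hy =>
        obtain ⟨S, hS, rfl⟩ := hy
        rw [sum_ev_mul_ev, if_neg]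
        exact fun h => hT ⟨Tᶜ, hsub hS h, compl_compl T⟩
end
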